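/- Let n = mℓ for positive integers m, ℓ, and let 1 ≤ s ≤ ℓ. The number of (m+2)-angulations of the once-punctured n-gon P_n^• with exactly s spokes equals m · C(n + ℓ - s - 1, n - 1). -/

import Mathlib

/-- An arc on the once-punctured polygon `P_n^•`: either a spoke from boundary
vertex `i` to the puncture, or the peripheral arc from `i` clockwise to `j`
(cut off region without the puncture); `per i i` is the loop at `i` cutting out a
once-punctured monogon. -/
inductive PArc (n : ℕ) where
  | spoke (i : Fin n)
  | per (i j : Fin n)
deriving DecidableEq

namespace PArc

/-- Clockwise distance from `i` to `j` on the boundary. -/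
def gp (n : ℕ) (i j : Fin n) : ℕ := (j.val + n - i.val) % n

/-- The clockwise length of the peripheral arc from `i` to `j` (`n` for the loop). -/
def len (n : ℕ) (i j : Fin n) : ℕ := if i = j then n else (j.val + n - i.val) % n

/-- An arc is valid (not isotopic to a boundary segment). -/
def Valid {n : ℕ} : PArc n → Prop
  | .spoke _ => True
  | .per i j => 2 ≤ len n i j

/-- Two arcs cross (have essential intersection); computed via their lifts to the
universal cover (an infinite strip with vertices `ℤ`, a peripheral arc `per i j`
lifting to chords `(a, a + len i j)` for `a ≡ i (mod n)` and a spoke lifting to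
downward rays at positions `≡ i (mod n)`). -/
def Cross {n : ℕ} : PArc n → PArc n → Prop
  | .spoke _, .spoke _ => False
  | .spoke s, .per i j => 0 < gp n i s ∧ gp n i s < len n i j
  | .per i j, .spoke s => 0 < gp n i s ∧ gp n i s < len n i j
  | .per i j, .per k l =>
      (0 < gp n i k ∧ gp n i k < len n i j ∧ len n i j < gp n i k + len n k l) ∨
      (0 < gp n k i ∧ gp n k i < len n k l ∧ len n k l < gp n k i + len n i j)

def isSpoke {n : ℕ} : PArc n → Bool
  | .spoke _ => true
  | .per _ _ => false

end PArc

/-- `(a, b)` is a lift (to the strip with vertices `ℤ`) of a peripheral arc of `T`. -/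
def IsChord {n : ℕ} (T : Finset (PArc n)) (a b : ℤ) : Prop :=
  ∃ i j : Fin n, PArc.per i j ∈ T ∧ ∃ t : ℤ, a = (i.val : ℤ) + t * n ∧ b = a + PArc.len n i j

/-- `a` is the position of a lift of a spoke of `T`. -/
def IsRay {n : ℕ} (T : Finset (PArc n)) (a : ℤ) : Prop :=
  ∃ s : Fin n, PArc.spoke s ∈ T ∧ ∃ t : ℤ, a = (s.val : ℤ) + t * n

/-- `a` and `b` are joined by a boundary edge or a lifted chord. -/
def IsEdge {n : ℕ} (T : Finset (PArc n)) (a b : ℤ) : Prop :=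
  b = a + 1 ∨ IsChord T a b

/-- `a < b` are consecutive elements of `S`. -/
def ConsecIn (S : Finset ℤ) (a b : ℤ) : Prop :=
  a ∈ S ∧ b ∈ S ∧ a < b ∧ ∀ x ∈ S, ¬(a < x ∧ x < b)

/-- `S` is the vertex set of a finite face (a subgon not containing the puncture)
of the lift of `T` to the strip. -/
def IsFinFace {n : ℕ} (T : Finset (PArc n)) (S : Finset ℤ) : Prop :=
  3 ≤ S.card ∧
  (∀ u v : ℤ, ConsecIn S u v → IsEdge T u v) ∧
  (∃ a ∈ S, ∃ b ∈ S, (∀ x ∈ S, a ≤ x ∧ x ≤ b) ∧ IsChord T a b ∧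
    ∀ u ∈ S, ∀ v ∈ S, u < v → IsChord T u v → (u = a ∧ v = b) ∨ ConsecIn S u v)

/-- Vertex `x` of the strip is strictly covered by some lifted chord of `T`. -/
def Covered {n : ℕ} (T : Finset (PArc n)) (x : ℤ) : Prop :=
  ∃ a b : ℤ, IsChord T a b ∧ a < x ∧ x < b

/-- `T` is an `(m+2)`-angulation of the once-punctured polygon `P_n^•`: a set of
pairwise noncrossing valid arcs, containing a spoke, all of whose finite faces are
`(m+2)`-gons, and all of whose faces at the puncture (those between consecutive
spoke lifts, with the puncture as one extra vertex) are `(m+2)`-gons. -/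
def IsAngulation (n m : ℕ) (T : Finset (PArc n)) : Prop :=
  (∀ a ∈ T, PArc.Valid a) ∧
  (∀ a ∈ T, ∀ b ∈ T, a ≠ b → ¬ PArc.Cross a b) ∧
  (∃ s : Fin n, PArc.spoke s ∈ T) ∧
  (∀ S : Finset ℤ, IsFinFace T S → S.card = m + 2) ∧
  (∀ a b : ℤ, IsRay T a → IsRay T b → a < b → (∀ x : ℤ, a < x → x < b → ¬ IsRay T x) →
    Nat.card {x : ℤ // a ≤ x ∧ x ≤ b ∧ ¬ Covered T x} = m + 1)

/-- The number of spokes of `T`. -/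
def spokeCount {n : ℕ} (T : Finset (PArc n)) : ℕ := (T.filter (fun a => a.isSpoke)).card

/-- Counterclockwise rotation of arcs by `c` vertex positions (`v_i ↦ v_{i-c}`). -/
def rotArc {n : ℕ} (c : Fin n) : PArc n → PArc n
  | .spoke i => .spoke (i - c)
  | .per i j => .per (i - c) (j - c)


/-! ### Lifts -/

lemma pa_fin_eq {n : ℕ} (i j : Fin n) (t : ℤ) (h : (i.val : ℤ) = j.val + t * n) : i = j := by
  have h1 : ((i.val : ℤ)) % n = (j.val : ℤ) % n := by
    rw [h, Int.add_mul_emod_self_right]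
  rw [Int.emod_eq_of_lt (by omega) (by have := i.2; omega),
    Int.emod_eq_of_lt (by omega) (by have := j.2; omega)] at h1
  exact Fin.ext (by omega)

lemma pa_exists_fin {n : ℕ} (hn : 0 < n) (x : ℤ) : ∃ (i : Fin n) (t : ℤ), x = (i.val : ℤ) + t * n := by
  have h0 := Int.emod_nonneg x (b := (n : ℤ)) (by omega)
  have h1 := Int.emod_lt_of_pos x (b := (n : ℤ)) (by omega)
  refine ⟨⟨(x % n).toNat, by omega⟩, x / n, ?_⟩
  have := Int.emod_add_mul_ediv x n
  simp only [Int.toNat_of_nonneg h0]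
  linarith [mul_comm (n : ℤ) (x / n)]

lemma pa_gp_spec {n : ℕ} (i j : Fin n) :
    PArc.gp n i j < n ∧ ∃ t : ℤ, (j.val : ℤ) = (i.val : ℤ) + PArc.gp n i j + t * n := by
  have hi := i.2
  have hj := j.2
  unfold PArc.gp
  refine ⟨Nat.mod_lt _ (by omega), ?_⟩
  by_cases h : i.val ≤ j.val
  · refine ⟨0, ?_⟩
    have : (j.val + n - i.val) % n = j.val - i.val := by
      rw [show j.val + n - i.val = (j.val - i.val) + n by omega, Nat.add_mod_right,
        Nat.mod_eq_of_lt (by omega)]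
    rw [this]; omega
  · refine ⟨-1, ?_⟩
    rw [Nat.mod_eq_of_lt (by omega)]; omega

lemma pa_len_spec {n : ℕ} (i j : Fin n) :
    1 ≤ PArc.len n i j ∧ PArc.len n i j ≤ n ∧
      ∃ t : ℤ, (j.val : ℤ) = (i.val : ℤ) + PArc.len n i j + t * n := by
  have hi := i.2
  obtain ⟨h1, t, ht⟩ := pa_gp_spec i j
  unfold PArc.len
  split_ifs with h
  · subst h
    exact ⟨by omega, le_refl _, -1, by ring⟩
  · change 1 ≤ PArc.gp n i j ∧ PArc.gp n i j ≤ n ∧ _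
    refine ⟨?_, h1.le, t, ht⟩
    by_contra hc
    have h0 : PArc.gp n i j = 0 := by omega
    rw [h0] at ht
    exact h (pa_fin_eq j i t (by simpa using ht)).symm

/-- congruent numbers at distance less than `n` are equal -/
lemma pa_cong {n : ℕ} {x y t : ℤ} (h : x = y + t * n) (h1 : x < y + n) (h2 : y < x + n) : x = y := by
  have : t = 0 := by
    by_contra ht
    rcases lt_or_gt_of_ne ht with ht | ht
    · have : t * n ≤ (-1) * n := mul_le_mul_of_nonneg_right (by omega) (by omega)
      omega
    · have : 1 * (n : ℤ) ≤ t * n := mul_le_mul_of_nonneg_right (by omega) (by omega)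
      omega
  subst this; omega

lemma pa_len_unique {n : ℕ} (i j : Fin n) (L t : ℤ) (h1 : 1 ≤ L) (h2 : L ≤ n)
    (h : (j.val : ℤ) = (i.val : ℤ) + L + t * n) : L = PArc.len n i j := by
  obtain ⟨h3, h4, t', ht'⟩ := pa_len_spec i j
  refine pa_cong (n := n) (t := t' - t) ?_ (by omega) (by omega)
  linarith [sub_mul t' t (n : ℤ)]

lemma pa_gp_unique {n : ℕ} (i j : Fin n) (L t : ℤ) (h1 : 0 ≤ L) (h2 : L < n)
    (h : (j.val : ℤ) = (i.val : ℤ) + L + t * n) : L = PArc.gp n i j := by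
  obtain ⟨h4, t', ht'⟩ := pa_gp_spec i j
  refine pa_cong (n := n) (t := t' - t) ?_ (by omega) (by omega)
  linarith [sub_mul t' t (n : ℤ)]

lemma pa_mem_per {n : ℕ} (T : Finset (PArc n)) (i j : Fin n) :
    PArc.per i j ∈ T ↔ IsChord T i.val (i.val + PArc.len n i j) := by
  constructor
  · intro h
    exact ⟨i, j, h, 0, by simp, rfl⟩
  · rintro ⟨i', j', h, t, h1, h2⟩
    have hi := pa_fin_eq i i' t h1
    subst hi
    obtain ⟨-, -, t1, ht1⟩ := pa_len_spec i j
    obtain ⟨-, -, t2, ht2⟩ := pa_len_spec i j'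
    have : j = j' := pa_fin_eq j j' (t1 - t2) (by linarith [sub_mul t1 t2 (n : ℤ)])
    subst this
    exact h

lemma pa_mem_spoke {n : ℕ} (T : Finset (PArc n)) (i : Fin n) :
    PArc.spoke i ∈ T ↔ IsRay T i.val := by
  constructor
  · intro h
    exact ⟨i, h, 0, by simp⟩
  · rintro ⟨i', h, t, h1⟩
    have hi := pa_fin_eq i i' t h1
    subst hi
    exact h

lemma pa_chord_shift {n : ℕ} {T : Finset (PArc n)} {a b : ℤ} (h : IsChord T a b) (t : ℤ) :
    IsChord T (a + t * n) (b + t * n) := by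
  obtain ⟨i, j, hij, t', h1, h2⟩ := h
  exact ⟨i, j, hij, t' + t, by rw [h1]; ring, by rw [h2]; ring⟩

lemma pa_ray_shift {n : ℕ} {T : Finset (PArc n)} {a : ℤ} (h : IsRay T a) (t : ℤ) :
    IsRay T (a + t * n) := by
  obtain ⟨i, hij, t', h1⟩ := h
  exact ⟨i, hij, t' + t, by rw [h1]; ring⟩

/-- Two sets with the same lifts agree. -/
lemma pa_ext {n : ℕ} {T T' : Finset (PArc n)} (h1 : ∀ a b, IsChord T a b ↔ IsChord T' a b)
    (h2 : ∀ a, IsRay T a ↔ IsRay T' a) : T = T' := by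
  ext x
  cases x with
  | spoke i => rw [pa_mem_spoke, pa_mem_spoke, h2]
  | per i j => rw [pa_mem_per, pa_mem_per, h1]

/-- The noncrossing part of the definition, in terms of lifts. -/
structure PALift {n : ℕ} (T : Finset (PArc n)) : Prop where
  lo : ∀ a b, IsChord T a b → a + 2 ≤ b
  hi : ∀ a b, IsChord T a b → b ≤ a + n
  nc : ∀ a b c d, IsChord T a b → IsChord T c d → a < c → c < b → b < d → False
  nr : ∀ a b x, IsChord T a b → IsRay T x → a < x → x < b → False

lemma pa_lift_of {n : ℕ} {T : Finset (PArc n)} (h1 : ∀ a ∈ T, PArc.Valid a)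
    (h2 : ∀ a ∈ T, ∀ b ∈ T, a ≠ b → ¬ PArc.Cross a b) : PALift T := by
  have hi : ∀ a b, IsChord T a b → b ≤ a + n := by
    rintro a b ⟨i, j, hij, t, rfl, rfl⟩
    have := (pa_len_spec i j).2.1
    omega
  refine ⟨?_, hi, ?_, ?_⟩
  · rintro a b ⟨i, j, hij, t, rfl, rfl⟩
    have : 2 ≤ PArc.len n i j := h1 _ hij
    omega
  · intro a b c d hab hcd hac hcb hbd
    have hab' := hi _ _ hab
    have hcd' := hi _ _ hcd
    obtain ⟨i, j, hij, t, e1, e2⟩ := hab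
    obtain ⟨k, l, hkl, t', e3, e4⟩ := hcd
    have hg : c - a = PArc.gp n i k := pa_gp_unique i k (c - a) (t - t') (by omega) (by omega)
      (by linarith [sub_mul t t' (n : ℤ)])
    by_cases he : PArc.per i j = PArc.per k l
    · injection he with he1 he2
      subst he1; subst he2
      have : c = a := pa_cong (n := n) (t := t' - t) (by rw [e1, e3]; ring) (by omega) (by omega)
      omega
    · refine h2 _ hij _ hkl he ?_
      left
      omega
  · intro a b x hab hx hax hxb
    have hab' := hi _ _ hab
    obtain ⟨i, j, hij, t, e1, e2⟩ := hab
    obtain ⟨k, hk, t', e3⟩ := hx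
    have hg : x - a = PArc.gp n i k := pa_gp_unique i k (x - a) (t - t') (by omega) (by omega)
      (by linarith [sub_mul t t' (n : ℤ)])
    refine h2 _ hij _ hk (by simp) ?_
    change 0 < PArc.gp n i k ∧ PArc.gp n i k < PArc.len n i j
    omega

lemma pa_lift_to {n : ℕ} {T : Finset (PArc n)} (h : PALift T) : (∀ a ∈ T, PArc.Valid a) ∧
    (∀ a ∈ T, ∀ b ∈ T, a ≠ b → ¬ PArc.Cross a b) := by
  have key : ∀ i j k : Fin n, ∀ l, PArc.per i j ∈ T → PArc.per k l ∈ T → 0 < PArc.gp n i k →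
      PArc.gp n i k < PArc.len n i j → PArc.len n i j < PArc.gp n i k + PArc.len n k l → False := by
    intro i j k l h1 h2 h3 h4 h5
    obtain ⟨-, t, ht⟩ := pa_gp_spec i k
    have h1' := (pa_mem_per T i j).1 h1
    have h2' := pa_chord_shift ((pa_mem_per T k l).1 h2) (-t)
    refine h.nc _ _ _ _ h1' h2' ?_ ?_ ?_ <;> rw [ht] <;> linarith
  have key2 : ∀ i j k : Fin n, PArc.per i j ∈ T → PArc.spoke k ∈ T → 0 < PArc.gp n i k →
      PArc.gp n i k < PArc.len n i j → False := by
    intro i j k h1 h2 h3 h4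
    obtain ⟨-, t, ht⟩ := pa_gp_spec i k
    have h1' := (pa_mem_per T i j).1 h1
    have h2' := pa_ray_shift ((pa_mem_spoke T k).1 h2) (-t)
    refine h.nr _ _ _ h1' h2' ?_ ?_ <;> rw [ht] <;> linarith
  constructor
  · intro x hx
    cases x with
    | spoke i => trivial
    | per i j =>
      have := h.lo _ _ ((pa_mem_per T i j).1 hx)
      change 2 ≤ PArc.len n i j
      omega
  · intro x hx y hy hxy hc
    cases x with
    | spoke i =>
      cases y with
      | spoke j => exact hc
      | per j k => exact key2 _ _ _ hy hx hc.1 hc.2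
    | per i j =>
      cases y with
      | spoke k => exact key2 _ _ _ hx hy hc.1 hc.2
      | per k l =>
        rcases hc with hc | hc
        · exact key _ _ _ _ hx hy hc.1 hc.2.1 hc.2.2
        · exact key _ _ _ _ hy hx hc.1 hc.2.1 hc.2.2

/-! ### Chains -/

lemma pa_chain (S : Finset ℤ) (f : ℤ → ℤ) (d : ℤ) (hf : ∀ u v, ConsecIn S u v → f v = f u + d)
    (x : ℤ) (hx : x ∈ S) : ∀ (k : ℕ) (y : ℤ), y ∈ S → x ≤ y →
    (S.filter (fun z => x ≤ z ∧ z < y)).card = k → f y = f x + d * k := by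
  intro k
  induction k with
  | zero =>
    intro y hy hxy hk
    rw [Finset.card_eq_zero] at hk
    have : ¬ x < y := fun hlt => by
      have : x ∈ S.filter (fun z => x ≤ z ∧ z < y) := by simp [hx, hlt]
      rw [hk] at this; simp at this
    have : y = x := by omega
    subst this; simp
  | succ k ih =>
    intro y hy hxy hk
    have hne : (S.filter (fun z => x ≤ z ∧ z < y)).Nonempty := by
      rw [← Finset.card_pos]; omega
    obtain ⟨p, hp, hmax⟩ := Finset.exists_max_image _ id hne
    simp only [Finset.mem_filter, id] at hp hmax
    have hc : ConsecIn S p y := ⟨hp.1, hy, hp.2.2, fun z hz hzz => by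
      have := hmax z ⟨hz, by omega, hzz.2⟩
      omega⟩
    have hins : S.filter (fun z => x ≤ z ∧ z < y) = insert p (S.filter (fun z => x ≤ z ∧ z < p)) := by
      ext z
      simp only [Finset.mem_filter, Finset.mem_insert]
      constructor
      · intro hz
        have := hmax z hz
        rcases eq_or_lt_of_le this with h | h
        · left; exact h
        · right; exact ⟨hz.1, hz.2.1, h⟩
      · rintro (rfl | hz)
        · exact hp
        · exact ⟨hz.1, hz.2.1, by omega⟩
    have hcard : (S.filter (fun z => x ≤ z ∧ z < p)).card = k := by
      rw [hins, Finset.card_insert_of_notMem (by simp)] at hk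
      omega
    rw [hf p y hc, ih p hp.1 hp.2.1 hcard]
    push_cast; ring

lemma pa_chain_lt (S : Finset ℤ) (f : ℤ → ℤ) (hf : ∀ u v, ConsecIn S u v → f v = f u + 1)
    (x y : ℤ) (hx : x ∈ S) (hy : y ∈ S) (hxy : x < y) : f x < f y := by
  have := pa_chain S f 1 hf x hx _ y hy hxy.le rfl
  have h2 : 0 < (S.filter (fun z => x ≤ z ∧ z < y)).card :=
    Finset.card_pos.2 ⟨x, by simp [hx, hxy]⟩
  omega

/-- chain from least to greatest element -/
lemma pa_chain_full (S : Finset ℤ) (f : ℤ → ℤ) (d : ℤ) (hf : ∀ u v, ConsecIn S u v → f v = f u + d)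
    (a b : ℤ) (ha : a ∈ S) (hb : b ∈ S) (hab : ∀ x ∈ S, a ≤ x ∧ x ≤ b) (k : ℕ)
    (hk : S.card = k + 1) : f b = f a + d * k := by
  refine pa_chain S f d hf a ha k b hb (hab b hb).1 ?_
  have : S.filter (fun z => a ≤ z ∧ z < b) = S.erase b := by
    ext z
    simp only [Finset.mem_filter, Finset.mem_erase]
    constructor
    · rintro ⟨h1, h2⟩; exact ⟨by omega, h1⟩
    · rintro ⟨h1, h2⟩
      have := hab z h2
      exact ⟨h2, by omega, by omega⟩
  rw [this, Finset.card_erase_of_mem hb]; omega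

/-- any non-least element that is at most the greatest lies in a consecutive interval -/
lemma pa_consec_exists (S : Finset ℤ) (a b y : ℤ) (ha : a ∈ S) (hb : b ∈ S) (h1 : a < y) (h2 : y ≤ b) :
    ∃ u v, ConsecIn S u v ∧ u < y ∧ y ≤ v := by
  obtain ⟨u, hu, humax⟩ := Finset.exists_max_image (S.filter (· < y)) id ⟨a, by simp [ha, h1]⟩
  obtain ⟨v, hv, hvmin⟩ := Finset.exists_min_image (S.filter (y ≤ ·)) id ⟨b, by simp [hb, h2]⟩
  simp only [Finset.mem_filter, id] at hu humax hv hvmin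
  refine ⟨u, v, ⟨hu.1, hv.1, by omega, ?_⟩, hu.2, hv.2⟩
  rintro x hx ⟨hx1, hx2⟩
  by_cases h : x < y
  · have := humax x ⟨hx, h⟩; omega
  · have := hvmin x ⟨hx, by omega⟩; omega

/-- the longest edge at an uncovered vertex ends at an uncovered vertex -/
lemma pa_longest (Q : ℤ → ℤ → Prop) (u N : ℤ) (hlt : ∀ p q, Q p q → p < q)
    (hnc : ∀ a b c d, Q a b → Q c d → a < c → c < b → b < d → False)
    (hb : ∀ q, Q u q → q ≤ N) (hex : ∃ q, Q u q) (hu : ¬ ∃ p q, Q p q ∧ p < u ∧ u < q) :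
    ∃ v, Q u v ∧ (∀ q, Q u q → q ≤ v) ∧ ¬ ∃ p q, Q p q ∧ p < v ∧ v < q := by
  obtain ⟨v, hv, hmax⟩ := Int.exists_greatest_of_bdd (P := fun q => Q u q) ⟨N, hb⟩ hex
  refine ⟨v, hv, hmax, ?_⟩
  rintro ⟨p, q, hpq, h1, h2⟩
  have huv := hlt _ _ hv
  rcases lt_trichotomy p u with h | h | h
  · exact hu ⟨p, q, hpq, h, by omega⟩
  · subst h
    have := hmax q hpq
    omega
  · exact hnc _ _ _ _ hv hpq h h1 h2

/-! ### Height functions -/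

structure PAHeight (n m s : ℕ) (H : ℤ → ℤ) (C : ℤ → ℕ) : Prop where
  step : ∀ x, H (x + 1) = H x + 1 - m * C x
  per : ∀ x, H (x + n) = H x + m * s

/-- edges given by a height function -/
def PAE (m : ℕ) (H : ℤ → ℤ) (a b : ℤ) : Prop :=
  a < b ∧ (∀ y, a < y → y < b → H y < H b) ∧ H b ≤ H a + 1 ∧ (m : ℤ) ∣ H a + 1 - H b

/-- left-to-right maxima -/
def PARec (H : ℤ → ℤ) (x : ℤ) : Prop := ∀ y, y < x → H y < H x

lemma pa_first (H : ℤ → ℤ) (hs : ∀ x, H (x + 1) ≤ H x + 1) (p q h : ℤ) (hp : H p ≤ h) (hq : h ≤ H q)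
    (hpq : p ≤ q) : ∃ x, p ≤ x ∧ x ≤ q ∧ H x = h ∧ ∀ y, p ≤ y → y < x → H y < h := by
  obtain ⟨x, ⟨hx1, hx2⟩, hmin⟩ := Int.exists_least_of_bdd (P := fun z => p ≤ z ∧ h ≤ H z)
    ⟨p, fun z hz => hz.1⟩ ⟨q, hpq, hq⟩
  have hlt : ∀ y, p ≤ y → y < x → H y < h := by
    intro y h1 h2
    by_contra hc
    have := hmin y ⟨h1, by omega⟩
    omega
  refine ⟨x, hx1, hmin q ⟨hpq, hq⟩, ?_, hlt⟩
  rcases eq_or_lt_of_le hx1 with h1 | h1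
  · subst h1; omega
  · have h3 := hlt (x - 1) (by omega) (by omega)
    have h4 := hs (x - 1)
    rw [sub_add_cancel] at h4
    omega

lemma pa_E_exists (m : ℕ) (H : ℤ → ℤ) (hs : ∀ x, H (x + 1) ≤ H x + 1) (a q h : ℤ) (haq : a < q)
    (h1 : H (a + 1) ≤ h) (h2 : h ≤ H a + 1) (h3 : (m : ℤ) ∣ H a + 1 - h) (h4 : h ≤ H q) :
    ∃ b, PAE m H a b ∧ b ≤ q ∧ H b = h := by
  obtain ⟨x, hx1, hx2, hx3, hx4⟩ := pa_first H hs (a + 1) q h h1 h4 (by omega)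
  refine ⟨x, ⟨by omega, fun y hy1 hy2 => ?_, by omega, by rw [hx3]; exact h3⟩, hx2, hx3⟩
  rw [hx3]; exact hx4 y (by omega) hy2

lemma pa_E_lt {m : ℕ} {H : ℤ → ℤ} {a b b' : ℤ} (h : PAE m H a b) (h' : PAE m H a b') (hlt : b < b') :
    H b < H b' := h'.2.1 b h.1 hlt

lemma pa_E_inj {m : ℕ} {H : ℤ → ℤ} {a b b' : ℤ} (h : PAE m H a b) (h' : PAE m H a b')
    (he : H b = H b') : b = b' := by
  rcases lt_trichotomy b b' with h1 | h1 | h1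
  · have := pa_E_lt h h' h1; omega
  · exact h1
  · have := pa_E_lt h' h h1; omega

lemma pa_E_nc {m : ℕ} {H : ℤ → ℤ} (a b c d : ℤ) (h : PAE m H a b) (h' : PAE m H c d) (h1 : a < c)
    (h2 : c < b) (h3 : b < d) : False := by
  have := h.2.1 c h1 h2
  have := h'.2.1 b h2 h3
  have := h'.2.2.1
  omega

section
variable {n m s : ℕ} {H : ℤ → ℤ} {C : ℤ → ℕ}

lemma PAHeight.hs (h : PAHeight n m s H C) (x : ℤ) : H (x + 1) ≤ H x + 1 := by
  rw [h.step]
  have : (0 : ℤ) ≤ m * C x := by positivity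
  omega

lemma PAHeight.E_succ (h : PAHeight n m s H C) (x : ℤ) : PAE m H x (x + 1) :=
  ⟨by omega, fun y h1 h2 => by omega, h.hs x, by rw [h.step]; simp⟩

lemma PAHeight.pert (h : PAHeight n m s H C) (x t : ℤ) : H (x + t * n) = H x + t * (m * s) := by
  induction t using Int.induction_on with
  | zero => simp
  | succ i ih =>
    rw [show x + ((i : ℤ) + 1) * n = (x + i * n) + n by ring, h.per, ih]; ring
  | pred i ih =>
    have := h.per (x + (-(i : ℤ) - 1) * n)
    rw [show x + (-(i : ℤ) - 1) * n + n = x + -(i : ℤ) * n by ring, ih] at this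
    linarith

lemma PAHeight.E_shift (h : PAHeight n m s H C) {a b : ℤ} (hE : PAE m H a b) (t : ℤ) :
    PAE m H (a + t * n) (b + t * n) := by
  obtain ⟨h1, h2, h3, h4⟩ := hE
  refine ⟨by omega, ?_, ?_, ?_⟩
  · intro y hy1 hy2
    have := h2 (y - t * n) (by omega) (by omega)
    have e := h.pert (y - t * n) t
    rw [sub_add_cancel] at e
    rw [e, h.pert]; omega
  · rw [h.pert, h.pert]; omega
  · rw [h.pert, h.pert]
    rwa [show H a + t * (m * s) + 1 - (H b + t * (m * s)) = H a + 1 - H b by ring]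

lemma PAHeight.rec_shift (h : PAHeight n m s H C) {a : ℤ} (hE : PARec H a) (t : ℤ) :
    PARec H (a + t * n) := by
  intro y hy
  have := hE (y - t * n) (by omega)
  have e := h.pert (y - t * n) t
  rw [sub_add_cancel] at e
  rw [e, h.pert]; omega

lemma PAHeight.ms (hm : 0 < m) (hs : 0 < s) : (1 : ℤ) ≤ m * s := by
  have : 0 < m * s := Nat.mul_pos hm hs
  exact_mod_cast this

lemma PAHeight.E_le (h : PAHeight n m s H C) (hm : 0 < m) (hs : 0 < s) (hn : 0 < n)
    {a b : ℤ} (hE : PAE m H a b) : b ≤ a + n := by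
  by_contra hc
  have := hE.2.1 (a + n) (by omega) (by omega)
  have h3 := hE.2.2.1
  rw [h.per] at this
  have := PAHeight.ms hm hs
  omega

lemma PAHeight.E_card (h : PAHeight n m s H C) (hm : 0 < m) (hs : 0 < s) (hn : 0 < n) (a : ℤ)
    [DecidablePred (PAE m H a)] : ((Finset.Ioc a (a + n)).filter (PAE m H a)).card = C a + 1 := by
  have hm' : (0 : ℤ) < m := by exact_mod_cast hm
  rw [← Finset.card_range (C a + 1)]
  symm
  refine Finset.card_bij' (fun k hk => Classical.choose (pa_E_exists m H h.hs a (a + n)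
    (H (a + 1) + m * k) (by omega) ?_ ?_ ?_ ?_)) (fun b _ => ((H b - H (a + 1)) / m).toNat) ?_ ?_ ?_ ?_
  · have : (0 : ℤ) ≤ m * k := by positivity
    omega
  · rw [h.step]
    have : (k : ℤ) ≤ C a := by simp at hk; omega
    have : (m : ℤ) * k ≤ m * C a := mul_le_mul_of_nonneg_left this (by omega)
    omega
  · rw [h.step]
    exact ⟨C a - k, by ring⟩
  · rw [h.step, h.per]
    have : (k : ℤ) ≤ C a := by simp at hk; omega
    have : (m : ℤ) * k ≤ m * C a := mul_le_mul_of_nonneg_left this (by omega)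
    have := PAHeight.ms hm hs
    omega
  · intro k hk
    generalize_proofs pf
    obtain ⟨h1, h2, h3⟩ := Classical.choose_spec pf
    simp only [Finset.mem_filter, Finset.mem_Ioc]
    exact ⟨⟨h1.1, h2⟩, h1⟩
  · intro b hb
    simp only [Finset.mem_filter, Finset.mem_Ioc] at hb
    obtain ⟨⟨hb1, hb2⟩, hE⟩ := hb
    simp only [Finset.mem_range]
    have h1 : H b - H (a + 1) ≤ m * C a := by
      have := hE.2.2.1
      rw [h.step]; omega
    have := Int.ediv_le_ediv hm' h1
    rw [Int.mul_ediv_cancel_left _ (by omega)] at this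
    omega
  · intro k hk
    generalize_proofs pf
    obtain ⟨h1, h2, h3⟩ := Classical.choose_spec pf
    simp only [h3]
    rw [add_sub_cancel_left, Int.mul_ediv_cancel_left _ (by omega)]
    simp
  · intro b hb
    generalize_proofs pf
    obtain ⟨h1, h2, h3⟩ := Classical.choose_spec pf
    simp only [Finset.mem_filter, Finset.mem_Ioc] at hb
    obtain ⟨⟨hb1, hb2⟩, hE⟩ := hb
    refine pa_E_inj h1 hE ?_
    rw [h3]
    have hle : H (a + 1) ≤ H b := by
      rcases eq_or_lt_of_le (show a + 1 ≤ b by omega) with e | e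
      · rw [e]
      · exact (hE.2.1 (a + 1) (by omega) e).le
    have hd : (m : ℤ) ∣ H b - H (a + 1) := by
      have := hE.2.2.2
      rw [h.step]
      have h5 : (m : ℤ) ∣ m * C a := ⟨_, rfl⟩
      have := dvd_sub h5 this
      rwa [show (m : ℤ) * C a - (H a + 1 - H b) = H b - (H a + 1 - m * C a) by ring] at this
    have h0 : 0 ≤ (H b - H (a + 1)) / m := Int.ediv_nonneg (by omega) (by omega)
    rw [Int.toNat_of_nonneg h0, Int.mul_ediv_cancel' hd]
    ring

lemma PAHeight.le_add (h : PAHeight n m s H C) (x : ℤ) (k : ℕ) : H (x + k) ≤ H x + k := by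
  induction k with
  | zero => simp
  | succ k ih =>
    have := h.hs (x + k)
    rw [add_assoc] at this
    push_cast
    omega

lemma PAHeight.rec_exists (h : PAHeight n m s H C) (hm : 0 < m) (hs : 0 < s) (hn : 0 < n) (k : ℤ) :
    ∃ x, PARec H x ∧ H x = k := by
  have hms := PAHeight.ms hm hs
  have hbd : ∀ z, k ≤ H z → -(|k - H 0 - n| * n) ≤ z := by
    intro z hz
    obtain ⟨i, t, rfl⟩ := pa_exists_fin hn z
    rw [h.pert] at hz
    have h1 := h.le_add 0 i.val
    rw [zero_add] at h1
    have hi := i.2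
    have h2 : -|k - H 0 - n| ≤ t := by
      by_contra hc
      push Not at hc
      have h5 := neg_abs_le (k - H 0 - n)
      have h6 := abs_nonneg (k - H 0 - n)
      have : t * (m * s) ≤ t * 1 := mul_le_mul_of_nonpos_left hms (by omega)
      omega
    have := mul_le_mul_of_nonneg_right h2 (show (0 : ℤ) ≤ n by omega)
    linarith
  have hne : ∃ z, k ≤ H z := by
    refine ⟨0 + |k - H 0| * n, ?_⟩
    rw [h.pert]
    have h5 := le_abs_self (k - H 0)
    have : |k - H 0| * 1 ≤ |k - H 0| * (m * s) := mul_le_mul_of_nonneg_left hms (abs_nonneg _)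
    omega
  obtain ⟨x, hx, hmin⟩ := Int.exists_least_of_bdd (P := fun z => k ≤ H z) ⟨_, hbd⟩ hne
  have hlt : ∀ y, y < x → H y < k := fun y hy => by
    by_contra hc
    have := hmin y (by omega)
    omega
  have hxk : H x = k := by
    have h1 := hlt (x - 1) (by omega)
    have h2 := h.hs (x - 1)
    rw [sub_add_cancel] at h2
    omega
  exact ⟨x, fun y hy => by rw [hxk]; exact hlt y hy, hxk⟩

lemma pa_rec_inj {x y : ℤ} (hx : PARec H x) (hy : PARec H y) (he : H x = H y) : x = y := by
  rcases lt_trichotomy x y with h | h | h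
  · have := hy x h; omega
  · exact h
  · have := hx y h; omega

lemma pa_rec_le {x y : ℤ} (hx : PARec H x) (hle : H x ≤ H y) : x ≤ y := by
  by_contra hc
  have := hx y (by omega)
  omega

lemma PAHeight.rec_iff (h : PAHeight n m s H C) (hm : 0 < m) (hs : 0 < s) (hn : 0 < n) (x : ℤ) :
    PARec H x ↔ ¬ ∃ a b, PAE m H a b ∧ a < x ∧ x < b := by
  constructor
  · rintro hx ⟨a, b, hE, h1, h2⟩
    have := hE.2.1 x h1 h2
    have := hE.2.2.1
    have := hx a h1
    omega
  · intro hx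
    by_contra hc
    unfold PARec at hc
    push Not at hc
    obtain ⟨y, ⟨hy1, hy2⟩, hmax⟩ := Int.exists_greatest_of_bdd (P := fun y => y < x ∧ H x ≤ H y)
      ⟨x, fun z hz => hz.1.le⟩ hc
    obtain ⟨b, hE, hb1, hb2⟩ := pa_E_exists m H h.hs y (y + n) (H y + 1) (by omega) (h.hs y) le_rfl
      (by simp) (by rw [h.per]; have := PAHeight.ms hm hs; omega)
    refine hx ⟨y, b, hE, hy1, ?_⟩
    by_contra hbx
    rcases eq_or_lt_of_le (not_lt.1 hbx) with e | e
    · subst e; omega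
    · have h7 := hE.1
      have := hmax b ⟨e, by omega⟩
      omega

end

/-! ### Rays -/

open Classical in
lemma pa_ray_card {n : ℕ} {T : Finset (PArc n)} (hn : 0 < n) {a : ℤ} (ha : IsRay T a) :
    ((Finset.Icc a (a + n)).filter (IsRay T)).card = spokeCount T + 1 := by
  have h1 : (Finset.Icc a (a + n)).filter (IsRay T)
      = insert (a + n) ((Finset.Ico a (a + n)).filter (IsRay T)) := by
    ext x
    simp only [Finset.mem_filter, Finset.mem_insert, Finset.mem_Icc, Finset.mem_Ico]
    constructor
    · rintro ⟨⟨h1, h2⟩, h3⟩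
      rcases eq_or_lt_of_le h2 with e | e
      · exact Or.inl e
      · exact Or.inr ⟨⟨h1, e⟩, h3⟩
    · rintro (rfl | ⟨⟨h1, h2⟩, h3⟩)
      · exact ⟨⟨by omega, le_rfl⟩, by simpa using pa_ray_shift ha 1⟩
      · exact ⟨⟨h1, h2.le⟩, h3⟩
  rw [h1, Finset.card_insert_of_notMem (by simp)]
  congr 1
  unfold spokeCount
  symm
  have hex : ∀ i : Fin n, ∃ x t : ℤ, a ≤ x ∧ x < a + n ∧ x = i.val + t * n := by
    intro i
    refine ⟨a + ((i.val : ℤ) - a) % n, -(((i.val : ℤ) - a) / n), ?_, ?_, ?_⟩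
    · have := Int.emod_nonneg ((i.val : ℤ) - a) (b := (n : ℤ)) (by omega)
      omega
    · have := Int.emod_lt_of_pos ((i.val : ℤ) - a) (b := (n : ℤ)) (by omega)
      omega
    · have := Int.emod_add_mul_ediv ((i.val : ℤ) - a) n
      linarith
  choose g t hg1 hg2 hg3 using hex
  refine Finset.card_bij (fun x _ => match x with
    | .spoke i => g i
    | .per _ _ => 0) ?_ ?_ ?_
  · intro x hx
    cases x with
    | per i j => exact absurd (Finset.mem_filter.1 hx).2 (by simp [PArc.isSpoke])
    | spoke i =>
      simp only [Finset.mem_filter] at hx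
      simp only [Finset.mem_filter, Finset.mem_Ico]
      exact ⟨⟨hg1 i, hg2 i⟩, i, hx.1, t i, hg3 i⟩
  · intro x hx y hy hxy
    cases x with
    | per i j => exact absurd (Finset.mem_filter.1 hx).2 (by simp [PArc.isSpoke])
    | spoke i =>
      cases y with
      | per i j => exact absurd (Finset.mem_filter.1 hy).2 (by simp [PArc.isSpoke])
      | spoke j =>
        simp only at hxy
        have e1 := hg3 i
        have e2 := hg3 j
        congr 1
        exact pa_fin_eq i j (t j - t i) (by linarith [sub_mul (t j) (t i) (n : ℤ)])
  · intro x hx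
    simp only [Finset.mem_filter, Finset.mem_Ico] at hx
    obtain ⟨⟨h1, h2⟩, i, hi, t', ht'⟩ := hx
    refine ⟨PArc.spoke i, Finset.mem_filter.2 ⟨hi, rfl⟩, ?_⟩
    change g i = x
    have e1 := hg3 i
    have := hg1 i
    have := hg2 i
    exact pa_cong (n := n) (t := t i - t') (by rw [e1, ht']; ring) (by omega) (by omega)

open Classical in
lemma pa_ray_chain {n : ℕ} {T : Finset (PArc n)} (hn : 0 < n) {a : ℤ} (ha : IsRay T a)
    (f : ℤ → ℤ) (d : ℤ) (hf : ∀ a b, IsRay T a → IsRay T b → a < b →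
      (∀ x : ℤ, a < x → x < b → ¬ IsRay T x) → f b = f a + d) :
    f (a + n) = f a + d * spokeCount T := by
  refine pa_chain_full ((Finset.Icc a (a + n)).filter (IsRay T)) f d ?_ a (a + n) ?_ ?_ ?_ _
    (pa_ray_card hn ha)
  · rintro u v ⟨h1, h2, h3, h4⟩
    simp only [Finset.mem_filter, Finset.mem_Icc] at h1 h2 h4
    refine hf u v h1.2 h2.2 h3 ?_
    intro x hx1 hx2 hx3
    exact h4 x ⟨⟨by omega, by omega⟩, hx3⟩ ⟨hx1, hx2⟩
  · simp [ha]
  · simp only [Finset.mem_filter, Finset.mem_Icc]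
    exact ⟨⟨by omega, le_rfl⟩, by simpa using pa_ray_shift ha 1⟩
  · intro x hx
    simp only [Finset.mem_filter, Finset.mem_Icc] at hx
    exact hx.1

/-! ### From heights to angulations -/

structure PAModel {n : ℕ} (m : ℕ) (H : ℤ → ℤ) (t : ℤ) (T : Finset (PArc n)) : Prop where
  chord : ∀ a b, IsChord T a b ↔ PAE m H a b ∧ a + 2 ≤ b
  ray : ∀ x, IsRay T x ↔ PARec H x ∧ (m : ℤ) ∣ H x - t

section
variable {n m s : ℕ} {H : ℤ → ℤ} {C : ℤ → ℕ} {t : ℤ} {T : Finset (PArc n)}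

lemma PAModel.edge (M : PAModel m H t T) (h : PAHeight n m s H C) (a b : ℤ) :
    IsEdge T a b ↔ PAE m H a b := by
  unfold IsEdge
  rw [M.chord]
  constructor
  · rintro (rfl | h1)
    · exact h.E_succ a
    · exact h1.1
  · intro h1
    have := h1.1
    by_cases e : b = a + 1
    · exact Or.inl e
    · exact Or.inr ⟨h1, by omega⟩

lemma PAModel.uncov (M : PAModel m H t T) (h : PAHeight n m s H C) (hm : 0 < m) (hs : 0 < s)
    (hn : 0 < n) (x : ℤ) : ¬ Covered T x ↔ PARec H x := by
  rw [h.rec_iff hm hs hn, not_iff_not]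
  unfold Covered
  constructor
  · rintro ⟨a, b, h1, h2⟩
    exact ⟨a, b, ((M.chord a b).1 h1).1, h2⟩
  · rintro ⟨a, b, h1, h2⟩
    exact ⟨a, b, (M.chord a b).2 ⟨h1, by omega⟩, h2⟩

lemma PAModel.face (M : PAModel m H t T) (h : PAHeight n m s H C) (hm : 0 < m)
    (S : Finset ℤ) (hS : IsFinFace T S) : S.card = m + 2 := by
  obtain ⟨hc, hcon, a, ha, b, hb, hab, hch, hno⟩ := hS
  have hm' : (1 : ℤ) ≤ m := by exact_mod_cast hm
  have hE := ((M.chord a b).1 hch).1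
  have hablt := hE.1
  have hend : ∀ u v b', ConsecIn S u v → PAE m H u b' → v < b' → b' ≤ b → b' ∈ S := by
    intro u v b' huv hub' hvb' hb'b
    obtain ⟨p, q, hpq, h1, h2⟩ := pa_consec_exists S v b b' huv.2.1 hb hvb' hb'b
    rcases eq_or_lt_of_le h2 with e | e
    · subst e; exact hpq.2.1
    · exfalso
      have hp : v ≤ p := by
        by_contra hc'
        exact hpq.2.2.2 v huv.2.1 ⟨by omega, by omega⟩
      have := huv.2.2.1
      exact pa_E_nc u b' p q hub' ((M.edge h p q).1 (hcon p q hpq)) (by omega) h1 e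
  have hstep : ∀ u v, ConsecIn S u v → u ≠ a → H v = H u + 1 := by
    intro u v huv hua
    have hEuv := (M.edge h u v).1 (hcon u v huv)
    have hau := hab u huv.1
    have hvb := hab v huv.2.1
    have huvlt := huv.2.2.1
    by_contra hne
    have hlt : H v < H u + 1 := lt_of_le_of_ne hEuv.2.2.1 hne
    have hub : H u < H b := hE.2.1 u (by omega) (by omega)
    obtain ⟨b', hb', hb'b, hHb'⟩ := pa_E_exists m H h.hs u b (H u + 1) (by omega) (h.hs u) le_rfl
      (by simp) (by omega)
    have hvb' : v < b' := by
      by_contra hc'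
      rcases eq_or_lt_of_le (not_lt.1 hc') with e | e
      · subst e; omega
      · have := pa_E_lt hb' hEuv e; omega
    have hb'S := hend u v b' huv hb' hvb' hb'b
    rcases hno u huv.1 b' hb'S hb'.1 ((M.chord u b').2 ⟨hb', by omega⟩) with h1 | h1
    · exact hua h1.1
    · exact h1.2.2.2 v huv.2.1 ⟨huvlt, hvb'⟩
  obtain ⟨u, x1, hux, hu1, hu2⟩ := pa_consec_exists S a b (a + 1) ha hb (by omega) (by omega)
  have hua : u = a := by have := hab u hux.1; omega
  subst hua
  have hx1b : x1 ≠ b := by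
    intro e
    subst e
    have : S ⊆ {u, x1} := by
      intro z hz
      have h1 := hab z hz
      have h2 := hux.2.2.2 z hz
      simp only [Finset.mem_insert, Finset.mem_singleton]
      omega
    have := Finset.card_le_card this
    have h5 : ({u, x1} : Finset ℤ).card ≤ 2 := Finset.card_le_two
    omega
  have hx1 := hab x1 hux.2.1
  have hux1 := hux.2.2.1
  have hEx := (M.edge h u x1).1 (hcon u x1 hux)
  have hHlt : H x1 < H b := hE.2.1 x1 (by omega) (by omega)
  have hdvd : (m : ℤ) ∣ H b - H x1 := by
    have := dvd_sub hEx.2.2.2 hE.2.2.2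
    rwa [show H u + 1 - H x1 - (H u + 1 - H b) = H b - H x1 by ring] at this
  have hge : H x1 + m ≤ H b := by
    have := Int.le_of_dvd (by omega) hdvd
    omega
  have heq : H b = H x1 + m := by
    by_contra hne
    have hx1' : H (u + 1) ≤ H x1 := by
      rcases eq_or_lt_of_le hu2 with e | e
      · rw [e]
      · exact (hEx.2.1 _ (by omega) e).le
    obtain ⟨b', hb', hb'b, hHb'⟩ := pa_E_exists m H h.hs u b (H x1 + m) (by omega) (by omega)
      (by have := hE.2.2.1; omega)
      (by
        have := dvd_sub hEx.2.2.2 (dvd_refl (m : ℤ))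
        rwa [show H u + 1 - H x1 - (m : ℤ) = H u + 1 - (H x1 + m) by ring] at this) hge
    have hvb' : x1 < b' := by
      by_contra hc'
      rcases eq_or_lt_of_le (not_lt.1 hc') with e | e
      · subst e; omega
      · have := pa_E_lt hb' hEx e; omega
    have hb'S := hend u x1 b' hux hb' hvb' hb'b
    rcases hno u ha b' hb'S hb'.1 ((M.chord u b').2 ⟨hb', by omega⟩) with h1 | h1
    · rw [h1.2] at hHb'; omega
    · exact h1.2.2.2 x1 hux.2.1 ⟨hux1, hvb'⟩
  have hchain := pa_chain_full (S.erase u) H 1 ?_ x1 b ?_ ?_ ?_ (S.card - 2) ?_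
  · omega
  · rintro p q ⟨h1, h2, h3, h4⟩
    simp only [Finset.mem_erase] at h1 h2 h4
    refine hstep p q ⟨h1.2, h2.2, h3, ?_⟩ h1.1
    rintro x hx ⟨hx1, hx2⟩
    have := hab p h1.2
    exact h4 x ⟨by omega, hx⟩ ⟨hx1, hx2⟩
  · exact Finset.mem_erase.2 ⟨by omega, hux.2.1⟩
  · exact Finset.mem_erase.2 ⟨by omega, hb⟩
  · intro x hx
    simp only [Finset.mem_erase] at hx
    have h1 := hab x hx.2
    have h2 := hux.2.2.2 x hx.2
    omega
  · rw [Finset.card_erase_of_mem ha]; omega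

lemma PAModel.consec (M : PAModel m H t T) (h : PAHeight n m s H C) (hm : 0 < m) (hs : 0 < s)
    (hn : 0 < n) (a b : ℤ) (ha : IsRay T a) (hb : IsRay T b) (hab : a < b)
    (hno : ∀ x : ℤ, a < x → x < b → ¬ IsRay T x) : H b = H a + m := by
  have hm' : (1 : ℤ) ≤ m := by exact_mod_cast hm
  have ha' := (M.ray a).1 ha
  have hb' := (M.ray b).1 hb
  obtain ⟨r, hr, hrH⟩ := h.rec_exists hm hs hn (H a + m)
  have hray : IsRay T r := by
    refine (M.ray r).2 ⟨hr, ?_⟩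
    rw [hrH, show H a + m - t = (H a - t) + m by ring]
    exact dvd_add ha'.2 (dvd_refl _)
  have har : a < r := by
    by_contra hc
    rcases eq_or_lt_of_le (not_lt.1 hc) with e | e
    · subst e; omega
    · have := ha'.1 r e; omega
  have hbr : b ≤ r := by
    by_contra hc
    exact hno r har (by omega) hray
  have hlt := hb'.1 a hab
  have hdvd : (m : ℤ) ∣ H b - H a := by
    have := dvd_sub hb'.2 ha'.2
    rwa [show H b - t - (H a - t) = H b - H a by ring] at this
  have := Int.le_of_dvd (by omega) hdvd
  have hrb : r ≤ b := pa_rec_le hr (by omega)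
  rw [show b = r by omega, hrH]

lemma PAModel.lift (M : PAModel m H t T) (h : PAHeight n m s H C) (hm : 0 < m) (hs : 0 < s)
    (hn : 0 < n) : PALift T := by
  refine ⟨fun a b hc => ((M.chord a b).1 hc).2, fun a b hc => h.E_le hm hs hn ((M.chord a b).1 hc).1,
    fun a b c d h1 h2 => pa_E_nc a b c d ((M.chord _ _).1 h1).1 ((M.chord _ _).1 h2).1, ?_⟩
  intro a b x h1 h2 h3 h4
  exact (h.rec_iff hm hs hn x).1 ((M.ray x).1 h2).1 ⟨a, b, ((M.chord _ _).1 h1).1, h3, h4⟩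

theorem PAModel.angulation (M : PAModel m H t T) (h : PAHeight n m s H C) (hm : 0 < m) (hs : 0 < s)
    (hn : 0 < n) : IsAngulation n m T ∧ spokeCount T = s := by
  have hm' : (1 : ℤ) ≤ m := by exact_mod_cast hm
  obtain ⟨h1, h2⟩ := pa_lift_to (M.lift h hm hs hn)
  obtain ⟨r, hr, hrH⟩ := h.rec_exists hm hs hn t
  have hray : IsRay T r := (M.ray r).2 ⟨hr, by rw [hrH]; simp⟩
  refine ⟨⟨h1, h2, ?_, M.face h hm, ?_⟩, ?_⟩
  · obtain ⟨i, hi, -⟩ := hray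
    exact ⟨i, hi⟩
  · intro a b ha hb hab hno
    have hHb := M.consec h hm hs hn a b ha hb hab hno
    have ha' := (M.ray a).1 ha
    have hb' := (M.ray b).1 hb
    have hbij : Nat.card {x : ℤ // a ≤ x ∧ x ≤ b ∧ ¬ Covered T x}
        = Nat.card {k : ℤ // k ∈ Finset.Icc (H a) (H b)} := by
      refine Nat.card_congr (Equiv.ofBijective (fun x => ⟨H x.1, ?_⟩) ⟨?_, ?_⟩)
      · obtain ⟨x, hx1, hx2, hx3⟩ := x
        rw [M.uncov h hm hs hn] at hx3
        simp only [Finset.mem_Icc]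
        constructor
        · rcases eq_or_lt_of_le hx1 with e | e
          · rw [e]
          · exact (hx3 a e).le
        · rcases eq_or_lt_of_le hx2 with e | e
          · rw [e]
          · exact (hb'.1 x e).le
      · rintro ⟨x, hx1, hx2, hx3⟩ ⟨y, hy1, hy2, hy3⟩ hxy
        rw [M.uncov h hm hs hn] at hx3 hy3
        simp only [Subtype.mk.injEq] at hxy ⊢
        exact pa_rec_inj hx3 hy3 hxy
      · rintro ⟨k, hk⟩
        simp only [Finset.mem_Icc] at hk
        obtain ⟨x, hx, hxk⟩ := h.rec_exists hm hs hn k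
        refine ⟨⟨x, pa_rec_le ha'.1 (by omega), pa_rec_le hx (by omega),
          (M.uncov h hm hs hn x).2 hx⟩, ?_⟩
        simp only [hxk]
    rw [hbij, Nat.card_eq_fintype_card, Fintype.card_coe, Int.card_Icc, hHb]
    omega
  · have := pa_ray_chain hn hray H m (M.consec h hm hs hn)
    rw [h.per] at this
    have h6 : (m : ℤ) * s = m * spokeCount T := by linarith
    have := mul_left_cancel₀ (by omega) h6
    omega

end

/-! ### From angulations to heights -/

section
variable {n : ℕ} {T : Finset (PArc n)}

lemma PALift.edge_lt (L : PALift T) (a b : ℤ) (h : IsEdge T a b) : a < b := by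
  rcases h with h | h
  · omega
  · have := L.lo a b h; omega

lemma PALift.edge_le (L : PALift T) (hn : 0 < n) (a b : ℤ) (h : IsEdge T a b) : b ≤ a + n := by
  rcases h with h | h
  · omega
  · exact L.hi a b h

lemma PALift.edge_nc (L : PALift T) (a b c d : ℤ) (h : IsEdge T a b) (h' : IsEdge T c d)
    (h1 : a < c) (h2 : c < b) (h3 : b < d) : False := by
  rcases h with h | h
  · omega
  · rcases h' with h' | h'
    · omega
    · exact L.nc a b c d h h' h1 h2 h3

lemma pa_cov_iff (x : ℤ) : Covered T x ↔ ∃ p q, IsEdge T p q ∧ p < x ∧ x < q := by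
  constructor
  · rintro ⟨p, q, h1, h2⟩
    exact ⟨p, q, Or.inr h1, h2⟩
  · rintro ⟨p, q, h1 | h1, h2⟩
    · omega
    · exact ⟨p, q, h1, h2⟩

open Classical in
lemma PALift.face_exists (L : PALift T) (a b : ℤ) (hab : IsChord T a b) :
    ∃ S, IsFinFace T S ∧ a ∈ S ∧ b ∈ S ∧ (∀ x ∈ S, a ≤ x ∧ x ≤ b) ∧
      ∀ u v, ConsecIn S u v → IsEdge T u v ∧ ¬ (u = a ∧ v = b) ∧
        ∀ q, IsEdge T u q → q ≤ b → ¬ (u = a ∧ q = b) → q ≤ v := by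
  have hlo := L.lo a b hab
  set Q : ℤ → ℤ → Prop := fun p q => IsEdge T p q ∧ a ≤ p ∧ q ≤ b ∧ ¬ (p = a ∧ q = b) with hQ
  set S : Finset ℤ := (Finset.Icc a b).filter (fun x => ¬ ∃ p q, Q p q ∧ p < x ∧ x < q) with hS
  have hmem : ∀ x, x ∈ S ↔ (a ≤ x ∧ x ≤ b) ∧ ¬ ∃ p q, Q p q ∧ p < x ∧ x < q := by
    intro x; simp [hS, Finset.mem_filter, Finset.mem_Icc]
  have haS : a ∈ S := by
    rw [hmem]
    refine ⟨by omega, ?_⟩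
    rintro ⟨p, q, ⟨h1, h2, h3, h4⟩, h5, h6⟩
    omega
  have hbS : b ∈ S := by
    rw [hmem]
    refine ⟨by omega, ?_⟩
    rintro ⟨p, q, ⟨h1, h2, h3, h4⟩, h5, h6⟩
    omega
  have hbd : ∀ x ∈ S, a ≤ x ∧ x ≤ b := fun x hx => ((hmem x).1 hx).1
  have hnext : ∀ u ∈ S, u < b → ∃ v ∈ S, Q u v ∧ (∀ q, Q u q → q ≤ v) := by
    intro u hu hub
    obtain ⟨⟨hu1, hu2⟩, hu3⟩ := (hmem u).1 hu
    obtain ⟨v, h1, h2, h3⟩ := pa_longest Q u b (fun p q h => L.edge_lt p q h.1)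
      (fun a b c d h h' => L.edge_nc a b c d h.1 h'.1) (fun q h => h.2.2.1)
      ⟨u + 1, Or.inl rfl, hu1, by omega, by omega⟩ hu3
    have := L.edge_lt _ _ h1.1
    exact ⟨v, (hmem v).2 ⟨⟨by omega, h1.2.2.1⟩, h3⟩, h1, h2⟩
  have hcons : ∀ u v, ConsecIn S u v → Q u v ∧ (∀ q, Q u q → q ≤ v) := by
    rintro u v ⟨h1, h2, h3, h4⟩
    have hv := hbd v h2
    obtain ⟨v', hv', hQ', hmax⟩ := hnext u h1 (by omega)
    have hlt := L.edge_lt _ _ hQ'.1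
    have : v = v' := by
      rcases lt_trichotomy v v' with h | h | h
      · exact absurd ⟨u, v', hQ', h3, h⟩ ((hmem v).1 h2).2
      · exact h
      · exact absurd ⟨hlt, h⟩ (h4 v' hv')
    subst this
    exact ⟨hQ', hmax⟩
  refine ⟨S, ⟨?_, fun u v h => (hcons u v h).1.1, a, haS, b, hbS, hbd, hab, ?_⟩, haS, hbS, hbd, ?_⟩
  · obtain ⟨v, hv, hQv, -⟩ := hnext a haS (by omega)
    have h1 := L.edge_lt _ _ hQv.1
    have h2 := hQv.2.2
    have hsub : ({a, v, b} : Finset ℤ) ⊆ S := by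
      intro x hx
      simp only [Finset.mem_insert, Finset.mem_singleton] at hx
      rcases hx with rfl | rfl | rfl <;> assumption
    have hc : ({a, v, b} : Finset ℤ).card = 3 := by
      rw [Finset.card_eq_three]
      exact ⟨a, v, b, by omega, by omega, by omega, rfl⟩
    rw [← hc]
    exact Finset.card_le_card hsub
  · intro u hu v hv huv hch
    by_cases h : u = a ∧ v = b
    · exact Or.inl h
    · right
      refine ⟨hu, hv, huv, ?_⟩
      intro x hx hxx
      have h1 := hbd u hu
      have h2 := hbd v hv
      exact ((hmem x).1 hx).2 ⟨u, v, ⟨Or.inr hch, h1.1, h2.2, h⟩, hxx⟩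
  · intro u v huv
    obtain ⟨h1, h2⟩ := hcons u v huv
    exact ⟨h1.1, h1.2.2.2, fun q hq1 hq2 hq3 => h2 q ⟨hq1, h1.2.1, hq2, hq3⟩⟩

open Classical in
/-- right endpoints of chords at `a`, up to `b` -/
noncomputable def paCh (T : Finset (PArc n)) (a b : ℤ) : Finset ℤ :=
  (Finset.Ioc a b).filter (IsChord T a)

/-- number of chords with left endpoint `a` -/
noncomputable def paC (T : Finset (PArc n)) (a : ℤ) : ℕ := (paCh T a (a + n)).card

lemma mem_paCh {a b x : ℤ} : x ∈ paCh T a b ↔ (a < x ∧ x ≤ b) ∧ IsChord T a x := by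
  simp [paCh]

lemma paC_shift (a t : ℤ) : paC T (a + t * n) = paC T a := by
  unfold paC
  symm
  refine Finset.card_bij (fun x _ => x + t * n) ?_ ?_ ?_
  · intro x hx
    rw [mem_paCh] at hx ⊢
    exact ⟨by omega, pa_chord_shift hx.2 t⟩
  · intro x _ y _ h
    omega
  · intro x hx
    rw [mem_paCh] at hx
    refine ⟨x - t * n, ?_, by omega⟩
    rw [mem_paCh]
    refine ⟨by omega, ?_⟩
    have := pa_chord_shift hx.2 (-t)
    rwa [show a + t * n + -t * n = a by ring, show x + -t * n = x - t * n by ring] at this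

lemma PALift.paC_eq (L : PALift T) (u v : ℤ) (hv : ∀ q, IsChord T u q → q ≤ v) :
    (paCh T u v).card = paC T u := by
  unfold paC
  congr 1
  ext x
  rw [mem_paCh, mem_paCh]
  constructor
  · rintro ⟨h1, h2⟩; exact ⟨⟨h1.1, L.hi _ _ h2⟩, h2⟩
  · rintro ⟨h1, h2⟩; exact ⟨⟨h1.1, hv _ h2⟩, h2⟩

variable {m : ℕ} {H : ℤ → ℤ}

lemma PALift.main (L : PALift T) (hm : 0 < m) (hF : ∀ S : Finset ℤ, IsFinFace T S → S.card = m + 2)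
    (hH : ∀ x, H (x + 1) = H x + 1 - m * paC T x) : ∀ (k : ℕ) (a b : ℤ), (b - a).toNat = k →
    IsEdge T a b → H b = H (a + 1) + m * (paCh T a b).card ∧ ∀ y, a < y → y < b → H y < H b := by
  intro k
  induction k using Nat.strong_induction_on with
  | _ k ih =>
  intro a b hk hab
  by_cases hb1 : b = a + 1
  · subst hb1
    have : paCh T a (a + 1) = ∅ := by
      ext x
      rw [mem_paCh]
      simp only [Finset.notMem_empty, iff_false]
      rintro ⟨h1, h2⟩
      have := L.lo _ _ h2
      omega
    rw [this]
    exact ⟨by simp, fun y h1 h2 => by omega⟩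
  have hch : IsChord T a b := hab.resolve_left hb1
  have hlo := L.lo a b hch
  obtain ⟨S, hface, haS, hbS, hbd, hcon⟩ := L.face_exists a b hch
  have hcard := hF S hface
  have hIH : ∀ u v, ConsecIn S u v → H v = H (u + 1) + m * (paCh T u v).card ∧
      ∀ y, u < y → y < v → H y < H v := by
    intro u v huv
    have h1 := hbd u huv.1
    have h2 := hbd v huv.2.1
    have h3 := huv.2.2.1
    obtain ⟨h4, h5, h6⟩ := hcon u v huv
    exact ih _ (by omega) u v rfl h4
  have hstep : ∀ u v, ConsecIn S u v → u ≠ a → H v = H u + 1 := by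
    intro u v huv hua
    have h1 := hbd u huv.1
    have h2 := hbd v huv.2.1
    have h3 := huv.2.2.1
    obtain ⟨h4, h5, h6⟩ := hcon u v huv
    rw [(hIH u v huv).1, L.paC_eq u v, hH]
    · ring
    · intro q hq
      refine h6 q (Or.inr hq) ?_ (by omega)
      by_contra hc
      exact L.nc a b u q hch hq (by omega) (by omega) (by omega)
  obtain ⟨u, x1, hux, hu1, hu2⟩ := pa_consec_exists S a b (a + 1) haS hbS (by omega) (by omega)
  have hua : u = a := by have := hbd u hux.1; omega
  subst hua
  obtain ⟨hx1e, hx1n, hx1max⟩ := hcon u x1 hux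
  have hx1 := hbd x1 hux.2.1
  have hux1 := hux.2.2.1
  have hstep' : ∀ p q, ConsecIn (S.erase u) p q → H q = H p + 1 := by
    rintro p q ⟨h1, h2, h3, h4⟩
    simp only [Finset.mem_erase] at h1 h2 h4
    refine hstep p q ⟨h1.2, h2.2, h3, ?_⟩ h1.1
    rintro x hx ⟨hx1, hx2⟩
    have := hbd p h1.2
    exact h4 x ⟨by omega, hx⟩ ⟨hx1, hx2⟩
  have hbE : b ∈ S.erase u := Finset.mem_erase.2 ⟨by omega, hbS⟩
  have hchain := pa_chain_full (S.erase u) H 1 hstep' x1 b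
    (Finset.mem_erase.2 ⟨by omega, hux.2.1⟩) hbE
    (by
      intro x hx
      simp only [Finset.mem_erase] at hx
      have h1 := hbd x hx.2
      have h2 := hux.2.2.2 x hx.2
      omega) m (by rw [Finset.card_erase_of_mem haS]; omega)
  have hins : paCh T u b = insert b (paCh T u x1) := by
    ext x
    rw [Finset.mem_insert, mem_paCh, mem_paCh]
    constructor
    · rintro ⟨h1, h2⟩
      by_cases e : x = b
      · exact Or.inl e
      · exact Or.inr ⟨⟨h1.1, hx1max x (Or.inr h2) h1.2 (by omega)⟩, h2⟩
    · rintro (rfl | ⟨h1, h2⟩)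
      · exact ⟨by omega, hch⟩
      · exact ⟨by omega, h2⟩
  constructor
  · rw [hins, Finset.card_insert_of_notMem (by rw [mem_paCh]; omega), hchain, (hIH u x1 hux).1]
    push_cast; ring
  · intro y hy1 hy2
    obtain ⟨p, v, hpv, h1, h2⟩ := pa_consec_exists S u b y haS hbS hy1 hy2.le
    have hvb := hbd v hpv.2.1
    have hyv : H y ≤ H v := by
      rcases eq_or_lt_of_le h2 with e | e
      · rw [e]
      · exact ((hIH p v hpv).2 y h1 e).le
    by_cases e : v = b
    · subst e
      exact (hIH p v hpv).2 y h1 hy2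
    · have := pa_chain_lt (S.erase u) H hstep' v b (Finset.mem_erase.2 ⟨by omega, hpv.2.1⟩) hbE
        (by omega)
      omega

open Classical in
lemma PALift.consec (L : PALift T) (hn : 0 < n) (hm : 0 < m)
    (hF : ∀ S : Finset ℤ, IsFinFace T S → S.card = m + 2)
    (hR : ∀ a b : ℤ, IsRay T a → IsRay T b → a < b → (∀ x : ℤ, a < x → x < b → ¬ IsRay T x) →
      Nat.card {x : ℤ // a ≤ x ∧ x ≤ b ∧ ¬ Covered T x} = m + 1)
    (hH : ∀ x, H (x + 1) = H x + 1 - m * paC T x) (a b : ℤ) (ha : IsRay T a) (hb : IsRay T b)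
    (hab : a < b) (hno : ∀ x : ℤ, a < x → x < b → ¬ IsRay T x) : H b = H a + m := by
  have hc := hR a b ha hb hab hno
  set S := (Finset.Icc a b).filter (fun x => ¬ Covered T x) with hS
  have hmem : ∀ x, x ∈ S ↔ a ≤ x ∧ x ≤ b ∧ ¬ Covered T x := by
    intro x; simp [hS, and_assoc]
  have hcard : S.card = m + 1 := by
    rw [← hc, ← Fintype.card_coe, ← Nat.card_eq_fintype_card]
    exact Nat.card_congr (Equiv.subtypeEquivRight hmem)
  have hray : ∀ x, IsRay T x → ¬ Covered T x := by
    rintro x hx ⟨p, q, h1, h2, h3⟩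
    exact L.nr p q x h1 hx h2 h3
  have := pa_chain_full S H 1 ?_ a b ((hmem a).2 ⟨le_rfl, hab.le, hray a ha⟩)
    ((hmem b).2 ⟨hab.le, le_rfl, hray b hb⟩) (fun x hx => ⟨((hmem x).1 hx).1, ((hmem x).1 hx).2.1⟩)
    m hcard
  · rw [this]; ring
  · rintro u v ⟨h1, h2, h3, h4⟩
    obtain ⟨hu1, hu2, hu3⟩ := (hmem u).1 h1
    obtain ⟨hv1, hv2, hv3⟩ := (hmem v).1 h2
    rw [pa_cov_iff] at hu3 hv3
    obtain ⟨w, hw1, hw2, hw3⟩ := pa_longest (IsEdge T) u (u + n) L.edge_lt L.edge_nc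
      (fun q h => L.edge_le hn u q h) ⟨u + 1, Or.inl rfl⟩ hu3
    have hlt := L.edge_lt _ _ hw1
    have : v = w := by
      rcases lt_trichotomy v w with h | h | h
      · exact absurd ⟨u, w, hw1, h3, h⟩ hv3
      · exact h
      · exact absurd ⟨hlt, h⟩ (h4 w ((hmem w).2 ⟨by omega, by omega, by rwa [pa_cov_iff]⟩))
    subst this
    rw [(L.main hm hF hH _ u v rfl hw1).1, L.paC_eq u v (fun q hq => hw2 q (Or.inr hq)), hH]
    ring

open Classical in
theorem pa_forward (hn : 0 < n) (hm : 0 < m) (hT : IsAngulation n m T)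
    (hH : ∀ x, H (x + 1) = H x + 1 - m * paC T x) :
    PAHeight n m (spokeCount T) H (paC T) ∧ ∃ t : Fin m, PAModel m H (t.val : ℤ) T := by
  obtain ⟨hV, hX, ⟨i0, hi0⟩, hF, hR⟩ := hT
  have hm' : (1 : ℤ) ≤ m := by exact_mod_cast hm
  have L := pa_lift_of hV hX
  have hx0 := (pa_mem_spoke T i0).1 hi0
  set x0 : ℤ := (i0.val : ℤ)
  have hcon := L.consec hn hm hF hR hH
  have hspos : 0 < spokeCount T := Finset.card_pos.2 ⟨_, Finset.mem_filter.2 ⟨hi0, rfl⟩⟩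
  have hdrift := pa_ray_chain hn hx0 H m hcon
  have hper : ∀ x, H (x + n) = H x + m * spokeCount T := by
    have hstep : ∀ x, H (x + 1 + n) - H (x + 1) = H (x + n) - H x := by
      intro x
      have h1 := hH (x + n)
      have h2 := paC_shift (T := T) x 1
      rw [one_mul] at h2
      rw [h2] at h1
      rw [show x + 1 + (n : ℤ) = x + n + 1 by ring, h1, hH x]; ring
    have hall : ∀ k : ℤ, H (x0 + k + n) - H (x0 + k) = m * spokeCount T := by
      intro k
      induction k using Int.induction_on with
      | zero => rw [add_zero, hdrift]; ring
      | succ i ih => rw [← ih, ← add_assoc]; exact hstep _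
      | pred i ih =>
        rw [← ih]
        have := hstep (x0 + (-(i : ℤ) - 1))
        rw [show x0 + (-(i : ℤ) - 1) + 1 = x0 + -(i : ℤ) by ring] at this
        exact this.symm
    intro x
    have := hall (x - x0)
    rw [add_sub_cancel] at this
    linarith
  have h : PAHeight n m (spokeCount T) H (paC T) := ⟨hH, hper⟩
  refine ⟨h, ?_⟩
  have hsub : ∀ a b, IsEdge T a b → PAE m H a b := by
    intro a b hab
    obtain ⟨h1, h2⟩ := L.main hm hF hH _ a b rfl hab
    refine ⟨L.edge_lt a b hab, h2, ?_, ?_⟩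
    · have hle : (paCh T a b).card ≤ paC T a := by
        refine Finset.card_le_card ?_
        intro x hx
        rw [mem_paCh] at hx ⊢
        exact ⟨⟨hx.1.1, L.hi _ _ hx.2⟩, hx.2⟩
      have hle' : ((paCh T a b).card : ℤ) ≤ paC T a := by exact_mod_cast hle
      have := mul_le_mul_of_nonneg_left hle' (show (0 : ℤ) ≤ m by omega)
      have := hH a
      omega
    · rw [h1, hH]
      exact ⟨paC T a - (paCh T a b).card, by ring⟩
  have hedge : ∀ a b, IsEdge T a b ↔ PAE m H a b := by
    intro a b
    refine ⟨hsub a b, fun hE => ?_⟩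
    have hcard := h.E_card hm hspos hn a
    have he : (Finset.Ioc a (a + n)).filter (IsEdge T a) = insert (a + 1) (paCh T a (a + n)) := by
      ext x
      rw [Finset.mem_insert, Finset.mem_filter, Finset.mem_Ioc, mem_paCh]
      constructor
      · rintro ⟨h1, h2 | h2⟩
        · exact Or.inl h2
        · exact Or.inr ⟨h1, h2⟩
      · rintro (h1 | ⟨h1, h2⟩)
        · exact ⟨by omega, Or.inl h1⟩
        · exact ⟨h1, Or.inr h2⟩
    have hcard2 : ((Finset.Ioc a (a + n)).filter (IsEdge T a)).card = paC T a + 1 := by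
      rw [he, Finset.card_insert_of_notMem]
      · rfl
      · rw [mem_paCh]
        rintro ⟨-, h2⟩
        have := L.lo _ _ h2
        omega
    have heq := Finset.eq_of_subset_of_card_le
      (show (Finset.Ioc a (a + n)).filter (IsEdge T a) ⊆ (Finset.Ioc a (a + n)).filter (PAE m H a) from
        fun x hx => by
          rw [Finset.mem_filter] at hx ⊢
          exact ⟨hx.1, hsub a x hx.2⟩) (by rw [hcard, hcard2])
    have hb : b ∈ (Finset.Ioc a (a + n)).filter (PAE m H a) := by
      rw [Finset.mem_filter, Finset.mem_Ioc]
      exact ⟨⟨hE.1, h.E_le hm hspos hn hE⟩, hE⟩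
    rw [← heq, Finset.mem_filter] at hb
    exact hb.2
  have hrayrec : ∀ x, IsRay T x → PARec H x := by
    intro x hx
    rw [h.rec_iff hm hspos hn]
    rintro ⟨a, b, h1, h2, h3⟩
    rcases (hedge a b).2 h1 with h4 | h4
    · omega
    · exact L.nr a b x h4 hx h2 h3
  have hcong : ∀ x y, IsRay T x → IsRay T y → x ≤ y → (m : ℤ) ∣ H y - H x := by
    intro x y hx hy hxy
    have := pa_chain ((Finset.Icc x y).filter (IsRay T)) H m ?_ x (by simp [hx, hxy]) _ y
      (by simp [hy, hxy]) hxy rfl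
    · rw [this]; simp
    · rintro u v ⟨h1, h2, h3, h4⟩
      simp only [Finset.mem_filter, Finset.mem_Icc] at h1 h2 h4
      refine hcon u v h1.2 h2.2 h3 ?_
      intro z hz1 hz2 hz3
      exact h4 z ⟨⟨by omega, by omega⟩, hz3⟩ ⟨hz1, hz2⟩
  have hcong0 : ∀ x, IsRay T x → (m : ℤ) ∣ H x - H x0 := by
    intro x hx
    rcases le_total x0 x with h1 | h1
    · exact hcong x0 x hx0 hx h1
    · rw [← neg_sub]
      exact (dvd_neg).2 (hcong x x0 hx hx0 h1)
  have hmod0 := Int.emod_nonneg (H x0) (b := (m : ℤ)) (by omega)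
  have hmod1 := Int.emod_lt_of_pos (H x0) (b := (m : ℤ)) (by omega)
  have hd0 : (m : ℤ) ∣ H x0 - H x0 % m := Int.dvd_self_sub_emod
  refine ⟨⟨(H x0 % m).toNat, by omega⟩, ?_, ?_⟩
  · intro a b
    rw [← hedge]
    constructor
    · intro h1
      exact ⟨Or.inr h1, L.lo a b h1⟩
    · rintro ⟨h1 | h1, h2⟩
      · omega
      · exact h1
  · intro x
    simp only [Int.toNat_of_nonneg hmod0]
    constructor
    · intro hx
      refine ⟨hrayrec x hx, ?_⟩
      have := dvd_add (hcong0 x hx) hd0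
      rwa [sub_add_sub_cancel] at this
    · rintro ⟨hx, hdx⟩
      have hex : ∃ y, y ≤ x ∧ IsRay T y := by
        refine ⟨x0 + (-|x0 - x|) * n, ?_, pa_ray_shift hx0 _⟩
        have h1 := le_abs_self (x0 - x)
        have h2 : |x0 - x| * 1 ≤ |x0 - x| * n :=
          mul_le_mul_of_nonneg_left (by omega) (abs_nonneg _)
        rw [neg_mul]
        omega
      obtain ⟨y, ⟨hy1, hy2⟩, hymax⟩ := Int.exists_greatest_of_bdd (P := fun y => y ≤ x ∧ IsRay T y)
        ⟨x, fun z hz => hz.1⟩ hex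
      obtain ⟨z, ⟨hz1, hz2⟩, hzmin⟩ := Int.exists_least_of_bdd (P := fun z => y < z ∧ IsRay T z)
        ⟨y, fun z hz => hz.1.le⟩ ⟨y + n, by omega, by simpa using pa_ray_shift hy2 1⟩
      have hHz := hcon y z hy2 hz2 hz1 (fun w hw1 hw2 hw3 => by
        have := hzmin w ⟨hw1, hw3⟩
        omega)
      have hxz : x < z := by
        by_contra hc
        have := hymax z ⟨by omega, hz2⟩
        omega
      have hlt : H x < H z := hrayrec z hz2 x hxz
      have hdvd : (m : ℤ) ∣ H x - H y := by
        have h1 := dvd_add (hcong0 y hy2) hd0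
        rw [sub_add_sub_cancel] at h1
        have := dvd_sub hdx h1
        rwa [sub_sub_sub_cancel_right] at this
      have hxy : H x ≤ H y := by
        by_contra hc
        have := Int.le_of_dvd (by omega) hdvd
        omega
      have : x = y := by
        have := pa_rec_le hx hxy
        omega
      rw [this]; exact hy2

end

/-! ### Assembling the bijection -/

/-- discrete integral of a function on the integers -/
noncomputable def paSum (g : ℤ → ℤ) (x : ℤ) : ℤ :=
  ∑ k ∈ Finset.range x.toNat, g k - ∑ k ∈ Finset.range (-x).toNat, g (-(k : ℤ) - 1)

lemma paSum_nat (g : ℤ → ℤ) (k : ℕ) : paSum g k = ∑ j ∈ Finset.range k, g j := by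
  simp [paSum]

lemma paSum_step (g : ℤ → ℤ) (x : ℤ) : paSum g (x + 1) = paSum g x + g x := by
  unfold paSum
  rcases le_or_gt 0 x with h | h
  · obtain ⟨k, rfl⟩ := Int.eq_ofNat_of_zero_le h
    rw [show ((k : ℤ) + 1).toNat = k + 1 by omega, show (k : ℤ).toNat = k by omega,
      show (-((k : ℤ) + 1)).toNat = 0 by omega, show (-(k : ℤ)).toNat = 0 by omega,
      Finset.sum_range_succ]
    simp
  · obtain ⟨k, rfl⟩ : ∃ k : ℕ, x = -(k : ℤ) - 1 := ⟨(-x - 1).toNat, by omega⟩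
    rw [show (-(k : ℤ) - 1 + 1).toNat = 0 by omega, show (-(k : ℤ) - 1).toNat = 0 by omega,
      show (-(-(k : ℤ) - 1 + 1)).toNat = k by omega, show (-(-(k : ℤ) - 1)).toNat = k + 1 by omega,
      Finset.sum_range_succ]
    simp

/-- periodic extension -/
def paExt {n : ℕ} (hn : 0 < n) (c : Fin n → ℕ) (x : ℤ) : ℕ :=
  c ⟨(x % n).toNat, by
    have h0 := Int.emod_nonneg x (b := (n : ℤ)) (by omega)
    have h1 := Int.emod_lt_of_pos x (b := (n : ℤ)) (by omega)
    omega⟩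

lemma paExt_add {n : ℕ} (hn : 0 < n) (c : Fin n → ℕ) (i : Fin n) (t : ℤ) :
    paExt hn c (i.val + t * n) = c i := by
  unfold paExt
  congr 1
  apply Fin.ext
  simp only [Int.add_mul_emod_self_right]
  rw [Int.emod_eq_of_lt (by omega) (by have := i.2; omega)]
  simp

noncomputable def paH {n : ℕ} (hn : 0 < n) (m : ℕ) (c : Fin n → ℕ) : ℤ → ℤ :=
  paSum (fun x => 1 - m * paExt hn c x)

lemma paH_step {n : ℕ} (hn : 0 < n) (m : ℕ) (c : Fin n → ℕ) (x : ℤ) :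
    paH hn m c (x + 1) = paH hn m c x + 1 - m * paExt hn c x := by
  unfold paH
  rw [paSum_step]; ring

lemma paH_zero {n : ℕ} (hn : 0 < n) (m : ℕ) (c : Fin n → ℕ) : paH hn m c 0 = 0 := by
  simp [paH, paSum]

lemma paH_n {n : ℕ} (hn : 0 < n) (m : ℕ) (c : Fin n → ℕ) :
    paH hn m c n = n - m * ((∑ i, c i : ℕ) : ℤ) := by
  unfold paH
  rw [paSum_nat, ← Fin.sum_univ_eq_sum_range (fun j : ℕ => (1 : ℤ) - m * paExt hn c (j : ℤ)) n]
  have : ∀ i : Fin n, paExt hn c (i.val : ℤ) = c i := by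
    intro i
    have := paExt_add hn c i 0
    simpa using this
  simp only [this, Finset.sum_sub_distrib, ← Finset.mul_sum]
  simp

lemma paH_height {n : ℕ} (hn : 0 < n) (m s : ℕ) (c : Fin n → ℕ)
    (hc : (n : ℤ) - m * ((∑ i, c i : ℕ) : ℤ) = m * s) :
    PAHeight n m s (paH hn m c) (paExt hn c) := by
  refine ⟨paH_step hn m c, ?_⟩
  have hstep : ∀ x, paH hn m c (x + 1 + n) - paH hn m c (x + 1) = paH hn m c (x + n) - paH hn m c x := by
    intro x
    have h1 := paH_step hn m c (x + n)
    have h2 : paExt hn c (x + n) = paExt hn c x := by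
      obtain ⟨i, t, rfl⟩ := pa_exists_fin hn x
      rw [paExt_add, show (i.val : ℤ) + t * n + n = i.val + (t + 1) * n by ring, paExt_add]
    rw [h2] at h1
    rw [show x + 1 + (n : ℤ) = x + n + 1 by ring, h1, paH_step hn m c x]; ring
  have hall : ∀ k : ℤ, paH hn m c (k + n) - paH hn m c k = m * s := by
    intro k
    induction k using Int.induction_on with
    | zero => rw [zero_add, paH_zero, paH_n, hc]; ring
    | succ i ih => rw [← ih]; exact hstep _
    | pred i ih =>
      rw [← ih]
      have := hstep (-(i : ℤ) - 1)
      rw [sub_add_cancel] at this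
      exact this.symm
  intro x
  have := hall x
  linarith

open Classical in
/-- the angulation with a given height function -/
noncomputable def paT (n m : ℕ) (H : ℤ → ℤ) (t : ℤ) : Finset (PArc n) :=
  (Finset.univ.filter (fun i : Fin n => PARec H i.val ∧ (m : ℤ) ∣ H i.val - t)).image PArc.spoke ∪
  (Finset.univ.filter (fun p : Fin n × Fin n => 2 ≤ PArc.len n p.1 p.2 ∧
    PAE m H p.1.val (p.1.val + PArc.len n p.1 p.2))).image (fun p => PArc.per p.1 p.2)

lemma paT_spoke {n m : ℕ} {H : ℤ → ℤ} {t : ℤ} (i : Fin n) :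
    PArc.spoke i ∈ paT n m H t ↔ PARec H i.val ∧ (m : ℤ) ∣ H i.val - t := by
  simp [paT]

lemma paT_per {n m : ℕ} {H : ℤ → ℤ} {t : ℤ} (i j : Fin n) :
    PArc.per i j ∈ paT n m H t ↔ 2 ≤ PArc.len n i j ∧ PAE m H i.val (i.val + PArc.len n i j) := by
  simp [paT]

lemma paT_model {n m s : ℕ} {H : ℤ → ℤ} {C : ℤ → ℕ} (h : PAHeight n m s H C) (hm : 0 < m)
    (hs : 0 < s) (hn : 0 < n) (t : ℤ) : PAModel m H t (paT n m H t) := by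
  constructor
  · intro a b
    constructor
    · rintro ⟨i, j, hij, k, rfl, rfl⟩
      rw [paT_per] at hij
      refine ⟨?_, by omega⟩
      have := h.E_shift hij.2 k
      rwa [add_right_comm] at this
    · rintro ⟨hE, h2⟩
      have hle := h.E_le hm hs hn hE
      obtain ⟨i, k, hk⟩ := pa_exists_fin hn a
      obtain ⟨j, k', hk'⟩ := pa_exists_fin hn b
      have hlen := pa_len_unique i j (b - a) (k - k') (by omega) (by omega)
        (by linarith [sub_mul k k' (n : ℤ)])
      refine ⟨i, j, ?_, k, hk, by omega⟩
      rw [paT_per]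
      refine ⟨by omega, ?_⟩
      have := h.E_shift hE (-k)
      rwa [show a + -k * n = i.val by rw [hk]; ring,
        show b + -k * n = i.val + PArc.len n i j by rw [← hlen, hk]; ring] at this
  · intro x
    constructor
    · rintro ⟨i, hi, k, rfl⟩
      rw [paT_spoke] at hi
      refine ⟨h.rec_shift hi.1 k, ?_⟩
      rw [h.pert, show H i.val + k * (m * s) - t = (H i.val - t) + m * (k * s) by ring]
      exact dvd_add hi.2 ⟨_, rfl⟩
    · rintro ⟨h1, h2⟩
      obtain ⟨i, k, hk⟩ := pa_exists_fin hn x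
      have e : x + -k * n = i.val := by rw [hk]; ring
      refine ⟨i, ?_, k, hk⟩
      rw [paT_spoke, ← e]
      refine ⟨h.rec_shift h1 _, ?_⟩
      rw [h.pert, show H x + -k * (m * s) - t = (H x - t) + m * (-k * s) by ring]
      exact dvd_add h2 ⟨_, rfl⟩

open Classical in
lemma PAModel.paC_eq {n m s : ℕ} {H : ℤ → ℤ} {C : ℤ → ℕ} {t : ℤ} {T : Finset (PArc n)}
    (M : PAModel m H t T) (h : PAHeight n m s H C) (hm : 0 < m)
    (hs : 0 < s) (hn : 0 < n) (a : ℤ) : paC T a = C a := by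
  have h1 := h.E_card hm hs hn a
  have h2 : (Finset.Ioc a (a + n)).filter (PAE m H a) = insert (a + 1) (paCh T a (a + n)) := by
    ext x
    rw [Finset.mem_insert, Finset.mem_filter, Finset.mem_Ioc, mem_paCh, M.chord]
    constructor
    · rintro ⟨h1, h2⟩
      by_cases e : x = a + 1
      · exact Or.inl e
      · exact Or.inr ⟨h1, h2, by omega⟩
    · rintro (rfl | ⟨h1, h2, -⟩)
      · exact ⟨by omega, h.E_succ a⟩
      · exact ⟨h1, h2⟩
  rw [h2, Finset.card_insert_of_notMem (by rw [mem_paCh, M.chord]; omega)] at h1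
  unfold paC
  omega

theorem pa_count (n m ℓ s : ℕ) (hn : n = m * ℓ) (hn0 : 0 < n) (hm : 0 < m) (hs : 0 < s) (hsl : s ≤ ℓ) :
    Nat.card {T : Finset (PArc n) // IsAngulation n m T ∧ spokeCount T = s}
      = Nat.card ({c : Fin n → ℕ // ∑ i, c i = ℓ - s} × Fin m) := by
  have hm' : (0 : ℤ) < m := by exact_mod_cast hm
  have hsum : ∀ k : ℕ, (n : ℤ) - m * (k : ℤ) = m * s ↔ k = ℓ - s := by
    intro k
    have e : (n : ℤ) = m * ℓ := by rw [hn]; push_cast; rfl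
    rw [e, ← mul_sub, mul_right_inj' (by omega)]
    omega
  have hht : ∀ c : {c : Fin n → ℕ // ∑ i, c i = ℓ - s},
      PAHeight n m s (paH hn0 m c.1) (paExt hn0 c.1) := fun c =>
    paH_height hn0 m s c.1 ((hsum _).2 c.2)
  have hmod : ∀ (c : {c : Fin n → ℕ // ∑ i, c i = ℓ - s}) (t : ℤ),
      PAModel m (paH hn0 m c.1) t (paT n m (paH hn0 m c.1) t) := fun c t =>
    paT_model (hht c) hm hs hn0 t
  symm
  refine Nat.card_congr (Equiv.ofBijective
    (fun p => ⟨paT n m (paH hn0 m p.1.1) (p.2.val : ℤ),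
      (hmod p.1 _).angulation (hht p.1) hm hs hn0⟩) ⟨?_, ?_⟩)
  · rintro ⟨c, t⟩ ⟨c', t'⟩ he
    simp only [Subtype.mk.injEq] at he
    have M := hmod c t.val
    have M' := hmod c' t'.val
    rw [← he] at M'
    have hcc : c = c' := by
      apply Subtype.ext
      funext i
      have h1 := M.paC_eq (hht c) hm hs hn0 (i.val + 0 * n)
      have h2 := M'.paC_eq (hht c') hm hs hn0 (i.val + 0 * n)
      rw [paExt_add] at h1 h2
      omega
    subst hcc
    obtain ⟨r, hr, hrH⟩ := (hht c).rec_exists hm hs hn0 t.val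
    have hray := (M.ray r).2 ⟨hr, by rw [hrH]; simp⟩
    have hd := ((M'.ray r).1 hray).2
    rw [hrH] at hd
    have h3 := t.2
    have h4 := t'.2
    have htt : t = t' := by
      apply Fin.ext
      have := Int.eq_zero_of_abs_lt_dvd hd (by rw [abs_lt]; omega)
      omega
    rw [htt]
  · rintro ⟨T, hT, hTs⟩
    set c : Fin n → ℕ := fun i => paC T i.val with hc
    have hext : ∀ x, paExt hn0 c x = paC T x := by
      intro x
      obtain ⟨i, t, rfl⟩ := pa_exists_fin hn0 x
      rw [paExt_add, paC_shift]
    have hstep : ∀ x, paH hn0 m c (x + 1) = paH hn0 m c x + 1 - m * paC T x := by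
      intro x
      rw [paH_step, hext]
    obtain ⟨h, t, M⟩ := pa_forward hn0 hm hT hstep
    have hcs : ∑ i, c i = ℓ - s := by
      rw [← hsum, ← paH_n hn0 m c]
      have := h.per 0
      rw [zero_add, paH_zero, zero_add, hTs] at this
      exact this
    refine ⟨(⟨c, hcs⟩, t), ?_⟩
    apply Subtype.ext
    have M' := hmod ⟨c, hcs⟩ t.val
    refine pa_ext (fun a b => ?_) (fun a => ?_)
    · rw [M'.chord, M.chord]
    · rw [M'.ray, M.ray]

/-- for `n = mℓ` and `1 ≤ s ≤ ℓ`, the number of `(m+2)`-angulations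
of the once-punctured `n`-gon with exactly `s` spokes is `m·C(n+ℓ-s-1, n-1)`. -/
theorem stmt10 (m ℓ s : ℕ) (hm : 0 < m) (hl : 0 < ℓ) (hs1 : 1 ≤ s) (hsl : s ≤ ℓ) :
    Nat.card {T : Finset (PArc (m * ℓ)) // IsAngulation (m * ℓ) m T ∧ spokeCount T = s}
      = m * Nat.choose (m * ℓ + ℓ - s - 1) (m * ℓ - 1) := by
  have hn0 : 0 < m * ℓ := Nat.mul_pos hm hl
  rw [pa_count (m * ℓ) m ℓ s rfl hn0 hm (by omega) hsl, Nat.card_prod,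
    ← Nat.card_congr (Sym.equivNatSumOfFintype (Fin (m * ℓ)) (ℓ - s)), Nat.card_eq_fintype_card,
    Sym.card_sym_eq_choose, Nat.card_eq_fintype_card, Fintype.card_fin, Fintype.card_fin, mul_comm]
  congr 1
  rw [show m * ℓ + ℓ - s - 1 = m * ℓ + (ℓ - s) - 1 by omega]
  exact (Nat.choose_symm_of_eq_add (by omega))
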